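/- For every z in the open unit disk, (1/(2π)) ∫_𝔻 (1 - |ς|²)² / (|1 - z·conj(ς)|·|z - ς|) dσ(ς) ≤ 4(2 - |z|²)/15, with equality at z = 0. -/

import Mathlib

open MeasureTheory Complex


lemma angular (t : ℝ) (h0 : 0 ≤ t) (h1 : t < 1) :
    ∫ θ in (-Real.pi)..Real.pi, 1 / (1 + t ^ 2 - 2 * t * Real.cos θ) ^ 3
      = 2 * Real.pi * ((1 + 4 * t ^ 2 + t ^ 4) / (1 - t ^ 2) ^ 5) := by
  have hq : 0 < 1 - t ^ 2 := by nlinarith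
  have hq' := hq.ne'
  have hD : ∀ θ : ℝ, 0 < 1 + t ^ 2 - 2 * t * Real.cos θ := by
    intro θ
    nlinarith [Real.cos_le_one θ, sq_nonneg (1 - t), mul_nonneg h0 (sub_nonneg.2 (Real.cos_le_one θ)),
      mul_pos (sub_pos.2 h1) (sub_pos.2 h1)]
  have hE : ∀ θ : ℝ, 0 < 1 - t * Real.cos θ := by
    intro θ
    nlinarith [Real.cos_le_one θ, mul_nonneg h0 (sub_nonneg.2 (Real.cos_le_one θ))]
  have hderiv : ∀ θ ∈ Set.uIcc (-Real.pi) Real.pi, HasDerivAt (fun θ : ℝ =>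
      t / (1 - t ^ 2) ^ 2 * (Real.sin θ / (1 + t ^ 2 - 2 * t * Real.cos θ) ^ 2)
      + 3 * (1 + t ^ 2) * t / (1 - t ^ 2) ^ 4 * (Real.sin θ / (1 + t ^ 2 - 2 * t * Real.cos θ))
      + (1 + 4 * t ^ 2 + t ^ 4) / (1 - t ^ 2) ^ 5 *
        (θ + 2 * Real.arctan (t * Real.sin θ / (1 - t * Real.cos θ))))
      (1 / (1 + t ^ 2 - 2 * t * Real.cos θ) ^ 3) θ := by
    intro θ _
    have hd := (hD θ).ne'
    have he := (hE θ).ne'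
    have dD : HasDerivAt (fun θ : ℝ => 1 + t ^ 2 - 2 * t * Real.cos θ)
        (2 * t * Real.sin θ) θ := by
      have := ((Real.hasDerivAt_cos θ).const_mul (2 * t)).const_sub (1 + t ^ 2)
      convert! this using 1; ring
    have dE : HasDerivAt (fun θ : ℝ => 1 - t * Real.cos θ) (t * Real.sin θ) θ := by
      have := ((Real.hasDerivAt_cos θ).const_mul t).const_sub 1
      convert! this using 1; ring
    have d1 := (Real.hasDerivAt_sin θ).div (dD.pow 2) (pow_ne_zero 2 hd)
    have d2 := (Real.hasDerivAt_sin θ).div dD hd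
    have d3 := (((Real.hasDerivAt_sin θ).const_mul t).div dE he).arctan
    have d4 := ((d1.const_mul (t / (1 - t ^ 2) ^ 2)).add
      (d2.const_mul (3 * (1 + t ^ 2) * t / (1 - t ^ 2) ^ 4))).add
      (((hasDerivAt_id θ).add (d3.const_mul 2)).const_mul ((1 + 4 * t ^ 2 + t ^ 4) / (1 - t ^ 2) ^ 5))
    refine d4.congr_deriv ?_
    have hs : Real.sin θ ^ 2 = 1 - Real.cos θ ^ 2 := by
      have := Real.sin_sq_add_cos_sq θ; linarith
    have key : 1 + 2 * (1 / (1 + (t * Real.sin θ / (1 - t * Real.cos θ)) ^ 2) *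
        ((t * Real.cos θ * (1 - t * Real.cos θ) - t * Real.sin θ * (t * Real.sin θ)) /
          (1 - t * Real.cos θ) ^ 2)) = (1 - t ^ 2) / (1 + t ^ 2 - 2 * t * Real.cos θ) := by
      have e1 : 1 + (t * Real.sin θ / (1 - t * Real.cos θ)) ^ 2
          = (1 + t ^ 2 - 2 * t * Real.cos θ) / (1 - t * Real.cos θ) ^ 2 := by
        rw [div_pow, mul_pow, hs]; field_simp; ring
      have e2 : t * Real.cos θ * (1 - t * Real.cos θ) - t * Real.sin θ * (t * Real.sin θ)
          = t * Real.cos θ - t ^ 2 := by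
        linear_combination (-t ^ 2) * hs
      rw [e1, e2]; field_simp; ring
    simp only [Pi.pow_apply, Pi.div_apply]
    rw [key]
    have e1 : Real.cos θ * (1 + t ^ 2 - 2 * t * Real.cos θ) ^ 2 - Real.sin θ *
        ((2:ℕ) * (1 + t ^ 2 - 2 * t * Real.cos θ) ^ (2 - 1) * (2 * t * Real.sin θ))
        = Real.cos θ * (1 + t ^ 2 - 2 * t * Real.cos θ) ^ 2 -
         4 * t * (1 + t ^ 2 - 2 * t * Real.cos θ) * (1 - Real.cos θ ^ 2) := by
      rw [← hs]; push_cast; ring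
    have e2 : Real.cos θ * (1 + t ^ 2 - 2 * t * Real.cos θ) - Real.sin θ * (2 * t * Real.sin θ)
        = Real.cos θ * (1 + t ^ 2 - 2 * t * Real.cos θ) - 2 * t * (1 - Real.cos θ ^ 2) := by
      rw [← hs]; ring
    rw [e1, e2]
    generalize Real.cos θ = c at *
    field_simp
    ring
  have hc : Continuous fun θ : ℝ => 1 / (1 + t ^ 2 - 2 * t * Real.cos θ) ^ 3 := by
    refine continuous_const.div (by fun_prop) fun θ => pow_ne_zero 3 (hD θ).ne'
  rw [intervalIntegral.integral_eq_sub_of_hasDerivAt hderiv (hc.intervalIntegrable _ _)]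
  simp
  ring

lemma cast_choose_aux (n k : ℕ) : ((n + k).choose k : ℝ) =
    (n + k).factorial / (n.factorial * k.factorial) := by
  rw [← Nat.choose_symm_add, Nat.cast_add_choose]

lemma cseries (y : ℝ) (h0 : 0 ≤ y) (h1 : y < 1) :
    HasSum (fun n : ℕ => ((n + 1 : ℝ) * (n + 2) / 2) ^ 2 * y ^ n)
      ((1 + 4 * y + y ^ 2) / (1 - y) ^ 5) := by
  have hy : ‖y‖ < 1 := by rwa [Real.norm_of_nonneg h0]
  have H := (((hasSum_choose_mul_geometric_of_norm_lt_one 4 hy).mul_left 6).sub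
    ((hasSum_choose_mul_geometric_of_norm_lt_one 3 hy).mul_left 6)).add
    (hasSum_choose_mul_geometric_of_norm_lt_one 2 hy)
  have : 1 - y ≠ 0 := by linarith
  convert! H using 1
  · ext n
    rw [cast_choose_aux n 4, cast_choose_aux n 3, cast_choose_aux n 2]
    have : (n.factorial : ℝ) ≠ 0 := by positivity
    simp only [Nat.factorial_succ]
    push_cast
    field_simp
    simp [Nat.factorial]
    ring
  · field_simp; ring

lemma tseries (y : ℝ) (h0 : 0 ≤ y) (h1 : y < 1) :
    HasSum (fun n : ℕ => (4 * n + 8 : ℝ) / 15 * y ^ n)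
      ((8 - 4 * y) / (15 * (1 - y) ^ 2)) := by
  have hy : ‖y‖ < 1 := by rwa [Real.norm_of_nonneg h0]
  have H := ((hasSum_choose_mul_geometric_of_norm_lt_one 1 hy).mul_left (4/15)).add
    ((hasSum_choose_mul_geometric_of_norm_lt_one 0 hy).mul_left (4/15))
  have : 1 - y ≠ 0 := by linarith
  convert! H using 1
  · ext n
    simp
    ring
  · field_simp; ring

lemma radial (a : ℝ) (h0 : 0 ≤ a) (h1 : a < 1) :
    ∫ r in (0:ℝ)..1, (1 - r ^ 2) ^ 2 * ((1 + 4 * (a * r) ^ 2 + (a * r) ^ 4) / (1 - (a * r) ^ 2) ^ 5)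
      ≤ (8 - 4 * a ^ 2) / (15 * (1 - a ^ 2) ^ 2) := by
  have hx0 : 0 ≤ a ^ 2 := by positivity
  have hx1 : a ^ 2 < 1 := by nlinarith
  have hs : HasSum (fun n : ℕ => ∫ r in (0:ℝ)..1,
      ((n + 1 : ℝ) * (n + 2) / 2) ^ 2 * (a ^ 2) ^ n * (r ^ (2 * n) * (1 - r ^ 2) ^ 2))
      (∫ r in (0:ℝ)..1, (1 - r ^ 2) ^ 2 *
        ((1 + 4 * (a * r) ^ 2 + (a * r) ^ 4) / (1 - (a * r) ^ 2) ^ 5)) := by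
    refine intervalIntegral.hasSum_integral_of_dominated_convergence
      (fun n _ => ((n + 1 : ℝ) * (n + 2) / 2) ^ 2 * (a ^ 2) ^ n) ?_ ?_ ?_ ?_ ?_
    · intro n; exact (Continuous.aestronglyMeasurable (by fun_prop))
    · intro n
      refine Filter.Eventually.of_forall fun r hr => ?_
      rw [Set.uIoc_of_le zero_le_one] at hr
      have hr0 := hr.1.le
      have hr2 : r ^ 2 ≤ 1 := by nlinarith [hr.2]
      have k1 : r ^ (2 * n) * (1 - r ^ 2) ^ 2 ≤ 1 :=
        mul_le_one₀ (pow_le_one₀ hr0 hr.2) (sq_nonneg _) (pow_le_one₀ (by linarith) (by nlinarith))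
      have k2 : 0 ≤ ((n + 1 : ℝ) * (n + 2) / 2) ^ 2 * (a ^ 2) ^ n := by positivity
      rw [Real.norm_of_nonneg (by positivity)]
      exact mul_le_of_le_one_right k2 k1
    · exact Filter.Eventually.of_forall fun r hr => (cseries _ hx0 hx1).summable
    · exact intervalIntegrable_const
    · refine Filter.Eventually.of_forall fun r hr => ?_
      rw [Set.uIoc_of_le zero_le_one] at hr
      have hr0 := hr.1.le
      have hr2 : r ^ 2 ≤ 1 := by nlinarith [hr.2]
      have := (cseries ((a * r) ^ 2) (by positivity) (by rw [mul_pow]; nlinarith)).mul_left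
        ((1 - r ^ 2) ^ 2)
      convert! this using 1
      · ext n; rw [mul_pow, mul_pow, ← pow_mul r]; ring
      · ring
  refine hasSum_le (fun n => ?_) hs (tseries _ hx0 hx1)
  have hi : (∫ r in (0:ℝ)..1, r ^ (2 * n) * (1 - r ^ 2) ^ 2)
      = (8:ℝ) / ((2 * n + 1) * (2 * n + 3) * (2 * n + 5)) := by
    have : ∀ r : ℝ, r ^ (2 * n) * (1 - r ^ 2) ^ 2
        = r ^ (2 * n) - 2 * r ^ (2 * n + 2) + r ^ (2 * n + 4) := fun r => by ring
    simp_rw [this]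
    rw [intervalIntegral.integral_add, intervalIntegral.integral_sub,
      intervalIntegral.integral_const_mul, integral_pow, integral_pow, integral_pow]
    · simp
      field_simp
      ring
    all_goals exact (Continuous.intervalIntegrable (by fun_prop) _ _)
  rw [intervalIntegral.integral_const_mul, hi, mul_right_comm]
  refine mul_le_mul_of_nonneg_right ?_ (by positivity)
  rw [← mul_div_assoc, div_le_div_iff₀ (by positivity) (by norm_num)]
  have hn : (0:ℝ) ≤ n := n.cast_nonneg
  have : 0 ≤ ((n:ℝ) + 2) * (n ^ 3 + 12 * n ^ 2 + 17 * n) := by positivity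
  nlinarith

lemma det_smul_one (c : ℂ) : (c • (1 : ℂ →L[ℝ] ℂ)).det = ‖c‖ ^ 2 := by
  rw [← Complex.normSq_eq_norm_sq, ← Algebra.norm_complex_apply, Algebra.norm_apply]
  rfl

lemma one_sub_ne (a : ℝ) (h0 : 0 ≤ a) (h1 : a < 1) (w : ℂ) (hw : ‖w‖ < 1) : 1 - a * w ≠ 0 := by
  intro h
  have : (a : ℂ) * w = 1 := by linear_combination -h
  have := congrArg norm this
  rw [norm_mul, norm_one, Complex.norm_of_nonneg h0] at this
  nlinarith [norm_nonneg w]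

lemma mob_norm (a : ℝ) (w : ℂ) (h : 1 - a * w ≠ 0) :
    1 - ‖((a : ℂ) - w) / (1 - a * w)‖ ^ 2 = (1 - a ^ 2) * (1 - ‖w‖ ^ 2) / ‖1 - a * w‖ ^ 2 := by
  have h' : ‖1 - a * w‖ ^ 2 ≠ 0 := pow_ne_zero _ (norm_ne_zero_iff.2 h)
  rw [norm_div, div_pow, eq_div_iff h', sub_mul, div_mul_cancel₀ _ h']
  simp only [← Complex.normSq_eq_norm_sq, Complex.normSq_apply]
  simp
  ring

lemma mob_ball (a : ℝ) (h0 : 0 ≤ a) (h1 : a < 1) (w : ℂ) (hw : ‖w‖ < 1) :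
    ‖((a : ℂ) - w) / (1 - a * w)‖ < 1 := by
  have h := one_sub_ne a h0 h1 w hw
  have h2 := mob_norm a w h
  have h3 : 0 < ‖1 - a * w‖ := norm_pos_iff.2 h
  have h4 : 0 < (1 - a ^ 2) * (1 - ‖w‖ ^ 2) / ‖1 - a * w‖ ^ 2 := by
    have : 0 < 1 - a ^ 2 := by nlinarith
    have : 0 < 1 - ‖w‖ ^ 2 := by nlinarith [norm_nonneg w]
    positivity
  nlinarith [norm_nonneg (((a : ℂ) - w) / (1 - a * w))]

lemma mob_inv (a : ℝ) (h0 : 0 ≤ a) (h1 : a < 1) (w : ℂ) (hw : ‖w‖ < 1) :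
    ((a : ℂ) - ((a : ℂ) - w) / (1 - a * w)) / (1 - a * (((a : ℂ) - w) / (1 - a * w))) = w := by
  have h := one_sub_ne a h0 h1 w hw
  have h2 := one_sub_ne a h0 h1 _ (mob_ball a h0 h1 w hw)
  rw [div_eq_iff h2]
  field_simp
  ring

lemma mob_change (a : ℝ) (h0 : 0 ≤ a) (h1 : a < 1) (u : ℂ) (hu : ‖u‖ = 1) :
    ∫ ς in Metric.ball (0 : ℂ) 1,
      (1 - ‖ς‖ ^ 2) ^ 2 / (‖1 - (a * u) * (starRingEnd ℂ) ς‖ * ‖a * u - ς‖)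
    = ∫ w in Metric.ball (0 : ℂ) 1, (1 - a ^ 2) ^ 2 * ((1 - ‖w‖ ^ 2) ^ 2 / (‖w‖ * ‖1 - a * w‖ ^ 6)) := by
  have hu0 : u ≠ 0 := by intro h; simp [h] at hu
  have himg : (fun w : ℂ => u * (((a : ℂ) - w) / (1 - a * w))) '' Metric.ball (0 : ℂ) 1
      = Metric.ball (0 : ℂ) 1 := by
    ext s
    simp only [Set.mem_image, mem_ball_zero_iff]
    constructor
    · rintro ⟨w, hw, rfl⟩
      rw [norm_mul, hu, one_mul]; exact mob_ball a h0 h1 w hw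
    · intro hs
      have hs' : ‖s / u‖ < 1 := by rw [norm_div, hu, div_one]; exact hs
      refine ⟨_, mob_ball a h0 h1 (s / u) hs', ?_⟩
      rw [mob_inv a h0 h1 _ hs']
      field_simp
  have hinj : Set.InjOn (fun w : ℂ => u * (((a : ℂ) - w) / (1 - a * w))) (Metric.ball (0 : ℂ) 1) := by
    intro w hw v hv h
    rw [mem_ball_zero_iff] at hw hv
    have h' := mul_left_cancel₀ hu0 h
    rw [← mob_inv a h0 h1 w hw, h', mob_inv a h0 h1 v hv]
  have hder : ∀ w ∈ Metric.ball (0 : ℂ) 1,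
      HasFDerivWithinAt (fun w : ℂ => u * (((a : ℂ) - w) / (1 - a * w)))
      ((-(u * (1 - a ^ 2) / (1 - a * w) ^ 2)) • (1 : ℂ →L[ℝ] ℂ)) (Metric.ball (0 : ℂ) 1) w := by
    intro w hw
    rw [mem_ball_zero_iff] at hw
    have h := one_sub_ne a h0 h1 w hw
    have d := (((hasDerivAt_id w).const_sub (a : ℂ)).div
      (((hasDerivAt_id w).const_mul (a : ℂ)).const_sub 1) h).const_mul u
    have d' : HasDerivAt (fun w : ℂ => u * (((a : ℂ) - w) / (1 - a * w)))
      (-(u * (1 - a ^ 2) / (1 - a * w) ^ 2)) w := by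
      refine d.congr_deriv ?_
      simp only [id]
      field_simp
      ring
    exact d'.complexToReal_fderiv.hasFDerivWithinAt
  conv_lhs => rw [← himg]
  rw [integral_image_eq_integral_abs_det_fderiv_smul volume measurableSet_ball hder hinj]
  refine setIntegral_congr_fun measurableSet_ball fun w hw => ?_
  rw [mem_ball_zero_iff] at hw
  have h := one_sub_ne a h0 h1 w hw
  have hx : 0 < 1 - a ^ 2 := by nlinarith
  have hN : 0 < ‖1 - a * w‖ := norm_pos_iff.2 h
  simp only [det_smul_one, smul_eq_mul]
  have e0 : ‖(1 - a ^ 2 : ℂ)‖ = 1 - a ^ 2 := by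
    rw [show (1 - a ^ 2 : ℂ) = ((1 - a ^ 2 : ℝ) : ℂ) by push_cast; rfl, Complex.norm_of_nonneg hx.le]
  have e1 : ‖-(u * (1 - a ^ 2) / (1 - a * w) ^ 2)‖ = (1 - a ^ 2) / ‖1 - a * w‖ ^ 2 := by
    rw [norm_neg, norm_div, norm_mul, hu, norm_pow, e0, one_mul]
  have e2 : 1 - ‖u * (((a : ℂ) - w) / (1 - a * w))‖ ^ 2
      = (1 - a ^ 2) * (1 - ‖w‖ ^ 2) / ‖1 - a * w‖ ^ 2 := by
    rw [norm_mul, hu, one_mul, mob_norm a w h]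
  have e3 : ‖a * u - u * (((a : ℂ) - w) / (1 - a * w))‖ = (1 - a ^ 2) * ‖w‖ / ‖1 - a * w‖ := by
    have : a * u - u * (((a : ℂ) - w) / (1 - a * w)) = u * ((1 - a ^ 2) * w / (1 - a * w)) := by
      field_simp; ring
    rw [this, norm_mul, hu, norm_div, norm_mul, e0, one_mul]
  have e4 : ‖1 - (a * u) * (starRingEnd ℂ) (u * (((a : ℂ) - w) / (1 - a * w)))‖
      = (1 - a ^ 2) / ‖1 - a * w‖ := by
    have huu : u * (starRingEnd ℂ) u = 1 := by
      rw [Complex.mul_conj, Complex.normSq_eq_norm_sq, hu]; simp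
    have : 1 - (a * u) * (starRingEnd ℂ) (u * (((a : ℂ) - w) / (1 - a * w)))
        = (starRingEnd ℂ) (1 - a * (((a : ℂ) - w) / (1 - a * w))) := by
      rw [map_mul, map_sub, map_mul, map_one, Complex.conj_ofReal]
      linear_combination (-a * (starRingEnd ℂ) (((a : ℂ) - w) / (1 - a * w))) * huu
    rw [this, Complex.norm_conj]
    have : 1 - a * (((a : ℂ) - w) / (1 - a * w)) = (1 - a ^ 2) / (1 - a * w) := by
      field_simp; ring
    rw [this, norm_div, e0]
  rw [e1, e2, e3, e4, abs_of_nonneg (by positivity)]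
  by_cases hw0 : ‖w‖ = 0
  · simp [hw0]
  field_simp

lemma polar_part (a : ℝ) (h0 : 0 ≤ a) (h1 : a < 1) :
    ∫ w in Metric.ball (0 : ℂ) 1, ((1 - ‖w‖ ^ 2) ^ 2 / (‖w‖ * ‖1 - a * w‖ ^ 6))
    = ∫ r in (0:ℝ)..1, ∫ θ in (-Real.pi)..Real.pi,
        (1 - r ^ 2) ^ 2 * (1 / (1 + (a * r) ^ 2 - 2 * (a * r) * Real.cos θ) ^ 3) := by
  rw [← integral_indicator measurableSet_ball, ← Complex.integral_comp_polarCoord_symm]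
  have hms : MeasurableSet polarCoord.target := polarCoord.open_target.measurableSet
  have hcongr : ∀ p ∈ polarCoord.target,
      p.1 • (Metric.ball (0 : ℂ) 1).indicator
        (fun w : ℂ => (1 - ‖w‖ ^ 2) ^ 2 / (‖w‖ * ‖1 - a * w‖ ^ 6)) (Complex.polarCoord.symm p)
      = (Set.Iio (1:ℝ) ×ˢ (Set.univ : Set ℝ)).indicator (fun p : ℝ × ℝ => (1 - p.1 ^ 2) ^ 2 *
        (1 / (1 + (a * p.1) ^ 2 - 2 * (a * p.1) * Real.cos p.2) ^ 3)) p := by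
    rintro ⟨r, θ⟩ ⟨hr, -⟩
    have hr : 0 < r := hr
    have hn : ‖Complex.polarCoord.symm (r, θ)‖ = r := by
      rw [Complex.norm_polarCoord_symm, abs_of_pos hr]
    by_cases h : r < 1
    · rw [Set.indicator_of_mem (by rw [mem_ball_zero_iff, hn]; exact h),
        Set.indicator_of_mem (by simpa using h), hn]
      have hD : ‖1 - a * Complex.polarCoord.symm (r, θ)‖ ^ 2
          = 1 + (a * r) ^ 2 - 2 * (a * r) * Real.cos θ := by
        rw [← Complex.normSq_eq_norm_sq, Complex.normSq_apply, Complex.polarCoord_symm_apply]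
        simp [-Complex.ofReal_cos, -Complex.ofReal_sin]
        linear_combination (a * r) ^ 2 * Real.sin_sq_add_cos_sq θ
      rw [show ‖1 - a * Complex.polarCoord.symm (r, θ)‖ ^ 6
        = (‖1 - a * Complex.polarCoord.symm (r, θ)‖ ^ 2) ^ 3 by ring, hD, smul_eq_mul]
      field_simp
    · rw [Set.indicator_of_notMem (by rw [mem_ball_zero_iff, hn]; exact h),
        Set.indicator_of_notMem (by simpa using h), smul_zero]
  rw [setIntegral_congr_fun hms hcongr,
    setIntegral_indicator (measurableSet_Iio.prod MeasurableSet.univ)]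
  have hset : polarCoord.target ∩ Set.Iio (1:ℝ) ×ˢ (Set.univ : Set ℝ)
      = Set.Ioo (0:ℝ) 1 ×ˢ Set.Ioo (-Real.pi) Real.pi := by
    ext p; simp [polarCoord_target]; tauto
  have hint : IntegrableOn (fun p : ℝ × ℝ => (1 - p.1 ^ 2) ^ 2 *
        (1 / (1 + (a * p.1) ^ 2 - 2 * (a * p.1) * Real.cos p.2) ^ 3))
        (Set.Ioo (0:ℝ) 1 ×ˢ Set.Ioo (-Real.pi) Real.pi) (volume.prod volume) := by
    have : IntegrableOn (fun p : ℝ × ℝ => (1 - p.1 ^ 2) ^ 2 *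
        (1 / (1 + (a * p.1) ^ 2 - 2 * (a * p.1) * Real.cos p.2) ^ 3))
        (Set.Icc (0:ℝ) 1 ×ˢ Set.Icc (-Real.pi) Real.pi) (volume.prod volume) := by
      refine ContinuousOn.integrableOn_compact (isCompact_Icc.prod isCompact_Icc) ?_
      refine ContinuousOn.mul (by fun_prop) (continuousOn_const.div (by fun_prop) ?_)
      rintro ⟨r, θ⟩ ⟨⟨hr0, hr1⟩, -⟩
      have hr0 : 0 ≤ r := hr0
      have hr1 : r ≤ 1 := hr1
      have ht0 : 0 ≤ a * r := by positivity
      have ht1 : a * r < 1 := by nlinarith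
      refine pow_ne_zero 3 (ne_of_gt ?_)
      show 0 < 1 + (a * r) ^ 2 - 2 * (a * r) * Real.cos θ
      nlinarith [mul_nonneg ht0 (sub_nonneg.2 (Real.cos_le_one θ)),
        mul_pos (sub_pos.2 ht1) (sub_pos.2 ht1)]
    exact this.mono_set (Set.prod_mono Set.Ioo_subset_Icc_self Set.Ioo_subset_Icc_self)
  rw [hset, Measure.volume_eq_prod, setIntegral_prod _ hint,
    intervalIntegral.integral_of_le zero_le_one, integral_Ioc_eq_integral_Ioo]
  refine setIntegral_congr_fun measurableSet_Ioo fun r _ => ?_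
  simp only
  rw [intervalIntegral.integral_of_le (by linarith [Real.pi_pos]), integral_Ioc_eq_integral_Ioo]

lemma total (a : ℝ) (h0 : 0 ≤ a) (h1 : a < 1) (u : ℂ) (hu : ‖u‖ = 1) :
    (1 / (2 * Real.pi)) * ∫ ς in Metric.ball (0 : ℂ) 1,
      (1 - ‖ς‖ ^ 2) ^ 2 / (‖1 - (a * u) * (starRingEnd ℂ) ς‖ * ‖a * u - ς‖)
    = (1 - a ^ 2) ^ 2 * ∫ r in (0:ℝ)..1, (1 - r ^ 2) ^ 2 *
      ((1 + 4 * (a * r) ^ 2 + (a * r) ^ 4) / (1 - (a * r) ^ 2) ^ 5) := by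
  rw [mob_change a h0 h1 u hu, integral_const_mul, polar_part a h0 h1]
  have : ∫ r in (0:ℝ)..1, ∫ θ in (-Real.pi)..Real.pi,
        (1 - r ^ 2) ^ 2 * (1 / (1 + (a * r) ^ 2 - 2 * (a * r) * Real.cos θ) ^ 3)
      = ∫ r in (0:ℝ)..1, (2 * Real.pi) * ((1 - r ^ 2) ^ 2 *
      ((1 + 4 * (a * r) ^ 2 + (a * r) ^ 4) / (1 - (a * r) ^ 2) ^ 5)) := by
    refine intervalIntegral.integral_congr fun r hr => ?_
    rw [Set.uIcc_of_le zero_le_one] at hr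
    have hr0 := hr.1
    have hr1 := hr.2
    rw [intervalIntegral.integral_const_mul, angular (a * r) (by positivity) (by nlinarith)]
    ring
  rw [this, intervalIntegral.integral_const_mul]
  have hpi := Real.pi_ne_zero
  generalize (∫ r in (0:ℝ)..1, (1 - r ^ 2) ^ 2 *
      ((1 + 4 * (a * r) ^ 2 + (a * r) ^ 4) / (1 - (a * r) ^ 2) ^ 5)) = K
  field_simp


theorem stmt5 :
    (∀ z : ℂ, z ∈ Metric.ball (0 : ℂ) 1 →
      (1 / (2 * Real.pi)) * ∫ ς in Metric.ball (0 : ℂ) 1,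
          (1 - ‖ς‖ ^ 2) ^ 2 / (‖1 - z * (starRingEnd ℂ) ς‖ * ‖z - ς‖)
        ≤ 4 * (2 - ‖z‖ ^ 2) / 15) ∧
    (1 / (2 * Real.pi)) * (∫ ς in Metric.ball (0 : ℂ) 1,
        (1 - ‖ς‖ ^ 2) ^ 2 / (‖1 - (0:ℂ) * (starRingEnd ℂ) ς‖ * ‖(0:ℂ) - ς‖))
      = 4 * (2 - ‖(0:ℂ)‖ ^ 2) / 15 := by
  constructor
  · intro z hz
    rw [mem_ball_zero_iff] at hz
    have hz0 := norm_nonneg z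
    have H := total ‖z‖ hz0 hz (Complex.exp (z.arg * I)) (Complex.norm_exp_ofReal_mul_I _)
    rw [Complex.norm_mul_exp_arg_mul_I] at H
    rw [H]
    have hx : 0 < 1 - ‖z‖ ^ 2 := by nlinarith
    refine (mul_le_mul_of_nonneg_left (radial ‖z‖ hz0 hz) (sq_nonneg _)).trans (le_of_eq ?_)
    field_simp
    ring
  · have H := total 0 le_rfl one_pos 1 norm_one
    simp only [Complex.ofReal_zero, zero_mul] at H ⊢
    rw [H]
    have : ∀ r : ℝ, (1 - r ^ 2) ^ 2 = 1 - 2 * r ^ 2 + r ^ 4 := fun r => by ring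
    simp only [this]
    norm_num
    rw [intervalIntegral.integral_add, intervalIntegral.integral_sub,
      intervalIntegral.integral_const_mul, integral_pow, integral_pow,
      intervalIntegral.integral_const]
    · norm_num
    all_goals exact (Continuous.intervalIntegrable (by fun_prop) _ _)
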